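/- Let k be a positive integer and let M, N be nonnegative integers with |M − N| ≤ k. Then for every real number x, sin(x) · ∑_{l ∈ ℤ} C(M+N, M−kl)^2 · sin(|l|·x) ≥ 0. Equivalently, ∑_{l} C(M+N, M−kl)^2 · sin(|l|x)/sin(x) ≥ 0 wherever sin(x) ≠ 0. -/

import Mathlib

/-- Binomial coefficient `C(n, b)` with integer lower index, zero unless `0 ≤ b ≤ n`. -/
def zchoose (n : ℕ) (b : ℤ) : ℕ := if 0 ≤ b then n.choose b.toNat else 0

theorem zchoose_natCast (n b : ℕ) : zchoose n b = n.choose b := by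
  simp [zchoose]

theorem zchoose_of_neg (n : ℕ) {b : ℤ} (hb : b < 0) : zchoose n b = 0 := by
  simp [zchoose, hb]

theorem zchoose_of_lt (n : ℕ) {b : ℤ} (hb : (n : ℤ) < b) : zchoose n b = 0 := by
  lift b to ℕ using by lia
  rw [zchoose_natCast, Nat.choose_eq_zero_of_lt (by lia)]

theorem zchoose_succ (n : ℕ) (b : ℤ) :
    zchoose (n + 1) b = zchoose n b + zchoose n (b - 1) := by
  rcases lt_trichotomy b 0 with hb | rfl | hb
  · simp [zchoose_of_neg _ hb, zchoose_of_neg n (show b - 1 < 0 by lia)]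
  · simp [zchoose]
  · obtain ⟨m, rfl⟩ : ∃ m : ℕ, b = ((m + 1 : ℕ) : ℤ) := ⟨(b - 1).toNat, by lia⟩
    rw [show ((m + 1 : ℕ) : ℤ) - 1 = (m : ℕ) by simp, zchoose_natCast, zchoose_natCast,
      zchoose_natCast, Nat.choose_succ_succ, add_comm]

theorem zchoose_symm (n : ℕ) (b : ℤ) : zchoose n (n - b) = zchoose n b := by
  rcases lt_or_ge b 0 with hb | hb
  · rw [zchoose_of_neg n hb, zchoose_of_lt n (by lia)]
  rcases lt_or_ge (n : ℤ) b with hn | hn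
  · rw [zchoose_of_lt n hn, zchoose_of_neg n (by lia)]
  lift b to ℕ using hb
  rw [← Nat.cast_sub (by lia), zchoose_natCast, zchoose_natCast, Nat.choose_symm (by lia)]

theorem zchoose_mono {n : ℕ} {b c : ℤ} (hbc : b ≤ c) (hc : 2 * c ≤ n) :
    zchoose n b ≤ zchoose n c := by
  rcases lt_or_ge b 0 with hb | hb
  · simp [zchoose_of_neg n hb]
  lift b to ℕ using hb
  lift c to ℕ using by lia
  rw [zchoose_natCast, zchoose_natCast]
  have hbc' : b ≤ c := by lia
  have hc' : 2 * c ≤ n := by lia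
  clear hbc hc
  induction c, hbc' using Nat.le_induction with
  | base => rfl
  | succ c _ ih => exact (ih (by lia)).trans (Nat.choose_le_succ_of_lt_half_left (by lia))

theorem Nat.choose_sq_eq_sum {n a : ℕ} (ha : a ≤ n) :
    n.choose a ^ 2 = ∑ i ∈ Finset.range (a + 1),
      n.choose i * (n - i).choose i * (n - 2 * i).choose (a - i) := by
  have vandermonde : n.choose a = ∑ i ∈ Finset.range (a + 1), a.choose i * (n - a).choose i := by
    conv_lhs => rw [show n = (n - a) + a by lia, Nat.add_choose_eq,
      Finset.Nat.sum_antidiagonal_eq_sum_range_succ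
        (fun i j => (n - a).choose i * a.choose j)]
    refine Finset.sum_congr rfl fun i hi => ?_
    rw [Nat.choose_symm (by simp at hi; lia), mul_comm]
  rw [sq]
  nth_rw 2 [vandermonde]
  rw [Finset.mul_sum]
  refine Finset.sum_congr rfl fun i hi => ?_
  have hia : i ≤ a := by simp at hi; lia
  rw [← mul_assoc, Nat.choose_mul hia, mul_assoc, mul_assoc]
  congr 1
  rcases lt_or_ge (n - a) i with h | h
  · rw [Nat.choose_eq_zero_of_lt h]
    rcases lt_or_ge (n - i) i with h' | h'
    · simp [Nat.choose_eq_zero_of_lt h']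
    · rw [Nat.choose_eq_zero_of_lt (show n - 2 * i < a - i by lia)]
      simp
  · have := Nat.choose_mul (n := n - i) (k := n - a) (s := i) h
    rw [show n - i - i = n - 2 * i by lia] at this
    rw [← Nat.choose_symm (show a - i ≤ n - i by lia), show n - i - (a - i) = n - a by lia, this,
      ← Nat.choose_symm (show a - i ≤ n - 2 * i by lia)]
    congr 2
    lia

theorem zchoose_sq_eq_sum (n : ℕ) (b : ℤ) :
    zchoose n b ^ 2 = ∑ i ∈ Finset.range (n + 1),
      n.choose i * (n - i).choose i * zchoose (n - 2 * i) (b - i) := by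
  rcases lt_or_ge b 0 with hb | hb
  · rw [zchoose_of_neg n hb, Finset.sum_eq_zero fun i _ => ?_]
    · simp
    · rw [zchoose_of_neg _ (by lia), mul_zero]
  rcases lt_or_ge (n : ℤ) b with hn | hn
  · rw [zchoose_of_lt n hn, Finset.sum_eq_zero fun i hi => ?_]
    · simp
    · have hi' : i < n + 1 := by simpa using hi
      rw [zchoose_of_lt _ (by lia), mul_zero]
  lift b to ℕ using hb
  rw [zchoose_natCast, Nat.choose_sq_eq_sum (by lia)]
  rw [← Finset.sum_subset (Finset.range_subset_range.2 (show b + 1 ≤ n + 1 by lia))]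
  · refine Finset.sum_congr rfl fun i hi => ?_
    have hi' : i < b + 1 := by simpa using hi
    rw [← Nat.cast_sub (by lia), zchoose_natCast]
  · intro i _ hi
    have hi' : ¬ i < b + 1 := by simpa using hi
    rw [zchoose_of_neg _ (by lia), mul_zero]

/-- The section with step `k` of the binomial coefficients `C(n, ·)`, based at `a`, as the
coefficients of a sine polynomial in `|l| x`. -/
noncomputable def sineSection (k n : ℕ) (a : ℤ) (L : ℕ) (x : ℝ) : ℝ :=
  ∑ l ∈ Finset.Icc (-(L : ℤ)) L, (zchoose n (a - k * l) : ℝ) * Real.sin ((l.natAbs : ℝ) * x)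

theorem sineSection_succ (k n : ℕ) (a : ℤ) (L : ℕ) (x : ℝ) :
    sineSection k (n + 1) a L x = sineSection k n a L x + sineSection k n (a - 1) L x := by
  simp only [sineSection, ← Finset.sum_add_distrib, ← add_mul]
  refine Finset.sum_congr rfl fun l _ => ?_
  rw [zchoose_succ, show a - k * l - 1 = a - 1 - k * l by ring]
  push_cast
  rfl

theorem sineSection_symm (k n : ℕ) (a : ℤ) (L : ℕ) (x : ℝ) :
    sineSection k n (n - a) L x = sineSection k n a L x := by
  refine Finset.sum_nbij' (fun l => -l) (fun l => -l) ?_ ?_ ?_ ?_ ?_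
  · intro l hl
    simp at hl ⊢
    lia
  · intro l hl
    simp at hl ⊢
    lia
  · simp
  · simp
  · intro l _
    rw [← zchoose_symm, Int.natAbs_neg,
      show (n : ℤ) - (n - a - k * l) = a - k * -l by ring]

theorem sum_Icc_neg_self (f : ℤ → ℝ) (L : ℕ) :
    ∑ l ∈ Finset.Icc (-(L : ℤ)) L, f l =
      f 0 + ∑ j ∈ Finset.range L, (f (j + 1) + f (-(j + 1))) := by
  induction L with
  | zero => simp
  | succ L ih =>
    have : Finset.Icc (-((L + 1 : ℕ) : ℤ)) ((L + 1 : ℕ) : ℤ) =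
        insert ((L : ℤ) + 1) (insert (-((L : ℤ) + 1)) (Finset.Icc (-(L : ℤ)) L)) := by
      ext l
      simp only [Finset.mem_Icc, Finset.mem_insert]
      lia
    rw [this, Finset.sum_insert (by simp; lia), Finset.sum_insert (by simp), ih,
      Finset.sum_range_succ]
    ring

/-- Abel summation against a sequence that is maximal at its start. -/
theorem sum_antitone_mul_sub_nonneg {c u : ℕ → ℝ} (hc : Antitone c) (hc0 : ∀ j, 0 ≤ c j)
    (hu : ∀ j, u j ≤ u 0) (L : ℕ) :
    0 ≤ ∑ j ∈ Finset.range L, c j * (u j - u (j + 1)) := by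
  have key : c L * (u 0 - u L) ≤ ∑ j ∈ Finset.range L, c j * (u j - u (j + 1)) := by
    induction L with
    | zero => simp
    | succ L ih =>
      rw [Finset.sum_range_succ]
      nlinarith [mul_nonneg (sub_nonneg.2 (hc L.le_succ)) (sub_nonneg.2 (hu (L + 1)))]
  exact (mul_nonneg (hc0 L) (sub_nonneg.2 (hu L))).trans key

theorem Real.sin_mul_sin_succ_add_sin (x y : ℝ) :
    sin x * (sin (y + x) + sin y) = (1 + cos x) * (cos y - cos (y + x)) := by
  rw [sin_add, cos_add]
  linear_combination (cos y) * sin_sq_add_cos_sq x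

/-- Sine polynomials whose coefficients are symmetric about `1 / 2`. -/
theorem sin_mul_sum_of_symm {c : ℤ → ℝ} (hc : ∀ l, c (1 - l) = c l) (L : ℕ) (x : ℝ) :
    Real.sin x * ∑ l ∈ Finset.Icc (-(L : ℤ)) L, c l * Real.sin ((l.natAbs : ℝ) * x) =
      (1 + Real.cos x) * ∑ j ∈ Finset.range L,
        c (j + 1) * (Real.cos ((j : ℝ) * x) - Real.cos (((j + 1 : ℕ) : ℝ) * x)) +
      c (L + 1) * (Real.sin x * Real.sin (L * x)) := by
  rw [sum_Icc_neg_self]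
  induction L with
  | zero => simp
  | succ L ih =>
    rw [Finset.sum_range_succ, Finset.sum_range_succ, ← add_assoc, mul_add, ih]
    have h1 : (-((L : ℤ) + 1)).natAbs = L + 1 := by lia
    have h2 : ((L : ℤ) + 1).natAbs = L + 1 := by lia
    have h3 : c (-((L : ℤ) + 1)) = c (((L + 1 : ℕ) : ℤ) + 1) := by
      rw [← hc]
      congr 1
      push_cast
      ring
    have h4 := Real.sin_mul_sin_succ_add_sin x (L * x)
    rw [show (L : ℝ) * x + x = ((L + 1 : ℕ) : ℝ) * x by push_cast; ring] at h4
    rw [h1, h2, h3]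
    linear_combination c (L + 1) * h4

theorem sin_mul_sineSection_nonneg_of_eq {k n : ℕ} (hk : 0 < k) {a : ℤ} (ha : 2 * a = n + k)
    {L : ℕ} (hL : n ≤ L) (x : ℝ) : 0 ≤ Real.sin x * sineSection k n a L x := by
  rw [sineSection, sin_mul_sum_of_symm (c := fun l => (zchoose n (a - k * l) : ℝ))]
  · have hkL : (L : ℤ) ≤ k * L := le_mul_of_one_le_left (by lia) (by lia)
    have hlast : zchoose n (a - k * ((L : ℤ) + 1)) = 0 :=
      zchoose_of_neg _ (by rw [mul_add]; lia)
    simp only [hlast, Nat.cast_zero, zero_mul, add_zero]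
    refine mul_nonneg (by linarith [Real.neg_one_le_cos x]) ?_
    refine sum_antitone_mul_sub_nonneg (c := fun j : ℕ => (zchoose n (a - k * ((j : ℤ) + 1)) : ℝ))
      (u := fun j : ℕ => Real.cos (j * x)) ?_ (fun _ => Nat.cast_nonneg _) ?_ L
    · intro i j hij
      have h1 : (k : ℤ) * i ≤ k * j := by gcongr
      have h2 : 0 ≤ (k : ℤ) * i := by positivity
      exact Nat.cast_le.2 (zchoose_mono (by lia) (by rw [mul_add]; lia))
    · intro j
      simpa using Real.cos_le_one _
  · intro l
    rw [← zchoose_symm]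
    congr 2
    linear_combination (-1 : ℤ) * ha

theorem sin_mul_sineSection_nonneg {k n : ℕ} (hk : 0 < k) {a : ℤ} (ha : |2 * a - n| ≤ k)
    {L : ℕ} (hL : n ≤ L) (x : ℝ) : 0 ≤ Real.sin x * sineSection k n a L x := by
  induction n generalizing a with
  | zero =>
    rw [sineSection, Finset.sum_eq_zero fun l _ => ?_, mul_zero]
    rw [abs_le] at ha
    push_cast at ha
    rcases lt_trichotomy l 0 with hl | rfl | hl
    · rw [zchoose_of_lt, Nat.cast_zero, zero_mul]
      push_cast
      nlinarith
    · simp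
    · rw [zchoose_of_neg, Nat.cast_zero, zero_mul]
      nlinarith
  | succ n ih =>
    rcases lt_or_eq_of_le ha with hlt | heq
    · rw [abs_lt] at hlt
      rw [sineSection_succ, mul_add]
      exact add_nonneg (ih (by rw [abs_le]; lia) (by lia)) (ih (by rw [abs_le]; lia) (by lia))
    · rcases (abs_eq (by lia)).1 heq with h | h
      · exact sin_mul_sineSection_nonneg_of_eq hk (by lia) hL x
      · rw [← sineSection_symm]
        exact sin_mul_sineSection_nonneg_of_eq hk (by lia) hL x

theorem stmt17 (k M N : ℕ) (hk : 0 < k) (h : |(M : ℤ) - N| ≤ k) (x : ℝ) :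
    0 ≤ Real.sin x *
      ∑ l ∈ Finset.Icc (-((M : ℤ) + N)) ((M : ℤ) + N),
        (zchoose (M + N) ((M : ℤ) - k * l) : ℝ) ^ 2 * Real.sin ((l.natAbs : ℝ) * x) := by
  have expand : ∑ l ∈ Finset.Icc (-((M : ℤ) + N)) ((M : ℤ) + N),
        (zchoose (M + N) ((M : ℤ) - k * l) : ℝ) ^ 2 * Real.sin ((l.natAbs : ℝ) * x) =
      ∑ i ∈ Finset.range (M + N + 1), ((M + N).choose i * (M + N - i).choose i : ℝ) *
        sineSection k (M + N - 2 * i) (M - i) (M + N) x := by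
    simp only [sineSection, Finset.mul_sum]
    rw [Finset.sum_comm]
    push_cast
    refine Finset.sum_congr rfl fun l _ => ?_
    rw [← Nat.cast_pow, zchoose_sq_eq_sum]
    push_cast
    rw [Finset.sum_mul]
    refine Finset.sum_congr rfl fun i _ => ?_
    rw [show (M : ℤ) - k * l - i = M - i - k * l by ring]
    ring
  rw [expand, Finset.mul_sum]
  refine Finset.sum_nonneg fun i _ => ?_
  rw [mul_left_comm]
  rcases lt_or_ge (M + N - i) i with hi | hi
  · simp [Nat.choose_eq_zero_of_lt hi]
  · exact mul_nonneg (by positivity)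
      (sin_mul_sineSection_nonneg hk (by rw [abs_le] at h ⊢; lia) (by lia) x)
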